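/- In the braid group B_3, for every integer q > 1, the element (σ₁σ₂)³σ₁σ₂^{−q} is conjugate to σ₁σ₂²σ₁²σ₂^{−q+2} (a word of length 3 + q when q ≥ 2 is written with σ₂^{−q+2} expanded). -/

import Mathlib

def braidRel : Set (FreeGroup (Fin 2)) :=
  {FreeGroup.of 0 * FreeGroup.of 1 * FreeGroup.of 0 *
    (FreeGroup.of 1 * FreeGroup.of 0 * FreeGroup.of 1)⁻¹}

/-- In any monoid, a consequence of the braid relation:
the full twist times `a` equals `b ^ 2 * a * b ^ 2 * a ^ 2`. -/
theorem braid_full_twist_mul {M : Type*} [Monoid M] {a b : M} (h : a * b * a = b * a * b) :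
    (a * b) ^ 3 * a = b ^ 2 * a * b ^ 2 * a ^ 2 :=
  calc (a * b) ^ 3 * a = (a * b * a) * (b * a * b) * a := by
        simp only [pow_succ, pow_zero, one_mul, mul_assoc]
    _ = (b * a * b) * (a * b * a) * a := by rw [h]
    _ = b * (a * b * a) * b * a ^ 2 := by simp only [pow_two, mul_assoc]
    _ = b ^ 2 * a * b ^ 2 * a ^ 2 := by rw [h]; simp only [pow_two, mul_assoc]

/-- If `a` and `b` satisfy the braid relation, then conjugation by `b ^ 2` takes
`a * b ^ 2 * a ^ 2 * b ^ (-q + 2)` to `(a * b) ^ 3 * a * b ^ (-q)`. -/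
theorem isConj_of_braid_relation {G : Type*} [Group G] {a b : G}
    (h : a * b * a = b * a * b) (q : ℤ) :
    IsConj ((a * b) ^ 3 * a * b ^ (-q)) (a * b ^ 2 * a ^ 2 * b ^ (-q + 2)) := by
  rw [braid_full_twist_mul h, isConj_comm, isConj_iff]
  refine ⟨b ^ 2, ?_⟩
  rw [zpow_add]
  group

theorem braid_relation_of_presentedGroup :
    (PresentedGroup.of 0 : PresentedGroup braidRel) * PresentedGroup.of 1 * PresentedGroup.of 0 =
      PresentedGroup.of 1 * PresentedGroup.of 0 * PresentedGroup.of 1 :=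
  PresentedGroup.mk_eq_mk_of_mul_inv_mem (Set.mem_singleton _)

theorem stmt_10 (q : ℤ) (hq : 1 < q) :
    IsConj
      (((PresentedGroup.of 0 : PresentedGroup braidRel) * PresentedGroup.of 1) ^ 3 *
        (PresentedGroup.of 0 : PresentedGroup braidRel) *
        (PresentedGroup.of 1 : PresentedGroup braidRel) ^ (-q))
      ((PresentedGroup.of 0 : PresentedGroup braidRel) *
        (PresentedGroup.of 1 : PresentedGroup braidRel) ^ (2 : ℕ) *
        (PresentedGroup.of 0 : PresentedGroup braidRel) ^ (2 : ℕ) *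
        (PresentedGroup.of 1 : PresentedGroup braidRel) ^ (-q + 2)) :=
  isConj_of_braid_relation braid_relation_of_presentedGroup q
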